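/- Let n ≥ 1 and 1 ≤ k ≤ n. For every λ = (λ_1,…,λ_n) ∈ ℝ^n with λ_i > 0 for all i, if i₀ is an index with λ_{i₀} = max_i λ_i, then λ_{i₀} · σ_{k−1}(λ|i₀) ≥ (k/n) · σ_k(λ). -/

import Mathlib

/-- The `k`-th elementary symmetric polynomial of the entries of `lam` indexed by the
finite set `s`. -/
noncomputable def esymm {n : ℕ} (k : ℕ) (s : Finset (Fin n)) (lam : Fin n → ℝ) : ℝ :=
  ∑ t ∈ s.powersetCard k, ∏ i ∈ t, lam i

theorem esymm_succ_insert {n : ℕ} (k : ℕ) {s : Finset (Fin n)} {i : Fin n} (hi : i ∉ s)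
    (lam : Fin n → ℝ) :
    esymm (k + 1) (insert i s) lam = esymm (k + 1) s lam + lam i * esymm k s lam := by
  have notMem_of_mem : ∀ t ∈ s.powersetCard k, i ∉ t := fun t ht h =>
    hi ((Finset.mem_powersetCard.mp ht).1 h)
  unfold esymm
  rw [Finset.powersetCard_succ_insert hi, Finset.sum_union, Finset.sum_image, Finset.mul_sum]
  · congr 1
    exact Finset.sum_congr rfl fun t ht => Finset.prod_insert (notMem_of_mem t ht)
  · intro t ht u hu htu
    rw [← Finset.erase_insert (notMem_of_mem t ht), ← Finset.erase_insert (notMem_of_mem u hu)]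
    exact congrArg (fun v => Finset.erase v i) htu
  · rw [Finset.disjoint_left]
    intro t ht ht'
    obtain ⟨u, -, rfl⟩ := Finset.mem_image.mp ht'
    exact hi ((Finset.mem_powersetCard.mp ht).1 (Finset.mem_insert_self i u))

theorem esymm_nonneg {n : ℕ} (k : ℕ) (s : Finset (Fin n)) {lam : Fin n → ℝ}
    (hlam : ∀ i, 0 ≤ lam i) : 0 ≤ esymm k s lam :=
  Finset.sum_nonneg fun _ _ => Finset.prod_nonneg fun i _ => hlam i

theorem esymm_erase_le_esymm_erase {n : ℕ} (k : ℕ) {s : Finset (Fin n)} {i j : Fin n}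
    (hi : i ∈ s) (hj : j ∈ s) {lam : Fin n → ℝ} (hlam : ∀ i, 0 ≤ lam i)
    (hij : lam i ≤ lam j) :
    esymm (k + 1) (s.erase j) lam ≤ esymm (k + 1) (s.erase i) lam := by
  rcases eq_or_ne i j with rfl | hne
  · rfl
  have hj' : s.erase j = insert i ((s.erase i).erase j) := by
    rw [Finset.erase_right_comm, Finset.insert_erase (Finset.mem_erase.mpr ⟨hne, hi⟩)]
  have hi' : s.erase i = insert j ((s.erase i).erase j) :=
    (Finset.insert_erase (Finset.mem_erase.mpr ⟨hne.symm, hj⟩)).symm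
  rw [hj', esymm_succ_insert k (by simp), hi', esymm_succ_insert k (by simp), ← hi']
  gcongr
  exact esymm_nonneg k _ hlam

theorem sum_esymm_erase {n : ℕ} (k : ℕ) (s : Finset (Fin n)) (lam : Fin n → ℝ) :
    ∑ i ∈ s, esymm k (s.erase i) lam = ((s.card : ℝ) - k) * esymm k s lam := by
  have sum_comm : ∑ i ∈ s, esymm k (s.erase i) lam =
      ∑ t ∈ s.powersetCard k, ∑ _i ∈ s \ t, ∏ j ∈ t, lam j := by
    refine Finset.sum_comm' fun i t => ?_
    simp only [Finset.mem_powersetCard, Finset.mem_sdiff, Finset.subset_erase]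
    tauto
  rw [sum_comm, esymm, Finset.mul_sum]
  refine Finset.sum_congr rfl fun t ht => ?_
  obtain ⟨hts, rfl⟩ := Finset.mem_powersetCard.mp ht
  rw [Finset.sum_const, nsmul_eq_mul, Finset.cast_card_sdiff hts]

/-- For `1 ≤ k ≤ n`, `λ` with positive entries and `i₀` a maximizing index:
`λ_{i₀} · σ_{k−1}(λ|i₀) ≥ (k/n) · σ_k(λ)`. -/
theorem max_mul_esymm_erase_ge (n k : ℕ) (hn : 1 ≤ n) (hk1 : 1 ≤ k) (hkn : k ≤ n)
    (lam : Fin n → ℝ) (hpos : ∀ i, 0 < lam i) (i₀ : Fin n) (hmax : ∀ i, lam i ≤ lam i₀) :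
    (k : ℝ) / (n : ℝ) * esymm k Finset.univ lam ≤
      lam i₀ * esymm (k - 1) (Finset.univ.erase i₀) lam := by
  obtain ⟨m, rfl⟩ := Nat.exists_eq_add_of_le' hk1
  rw [Nat.add_sub_cancel]
  have hsum := sum_esymm_erase (m + 1) Finset.univ lam
  have hle := Finset.card_nsmul_le_sum Finset.univ
    (fun i => esymm (m + 1) (Finset.univ.erase i) lam) _ fun i _ =>
    esymm_erase_le_esymm_erase m (Finset.mem_univ i) (Finset.mem_univ i₀)
      (fun i => (hpos i).le) (hmax i)
  have hsplit := esymm_succ_insert m (Finset.notMem_erase i₀ Finset.univ) lam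
  rw [Finset.insert_erase (Finset.mem_univ i₀)] at hsplit
  rw [hsum, nsmul_eq_mul, Finset.card_univ, Fintype.card_fin] at hle
  have hn' : (0 : ℝ) < n := by exact_mod_cast hn
  rw [div_mul_eq_mul_div, div_le_iff₀ hn']
  linear_combination hle + (n : ℝ) * hsplit
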